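/- arXiv:1303.5899 — 8 statements merged into one kernel-verified Lean document; each statement's English description precedes it below -/
import Mathlib

section
/- Let I = (ℓ,r) be an open interval, let 𝔰 : I → ℝ∖{0} be Borel measurable with 1/𝔰² locally integrable on I, let a ∈ ℝ∖{0}, and suppose 𝔟 = a·𝔰 (so 𝔣 ≡ a). Then for every x ∈ I the Feller test function satisfies v(x) = (1/(2a)) ∫_c^x (1 - exp(2a(z - x))) · 𝔰(z)^{-2} dz. -/
open MeasureTheory intervalIntegral Set

/-- **Feller test function for `𝔟 = a·𝔰`.**
If `𝔰 ≠ 0` is Borel measurable on the open interval `I = (ℓ, r)` with `1/𝔰²` locally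
integrable, `a ≠ 0`, and the mean/variance ratio is constant `𝔣 ≡ a` (i.e. the drift is
`𝔟 = a·𝔰`), then the Feller test function satisfies
`v(x) = (1/(2a)) ∫_c^x (1 - exp(2a(z - x))) 𝔰(z)⁻² dz` for every `x ∈ I`. -/
theorem feller_test_function_drift_const_ratio
    (ℓ r : EReal) (hlr : ℓ < r)
    (I : Set ℝ) (hI : I = {x : ℝ | ℓ < (x : EReal) ∧ (x : EReal) < r})
    (𝔰 : ℝ → ℝ)
    (h𝔰 : ∀ x ∈ I, 𝔰 x ≠ 0)
    (h𝔰meas : Measurable 𝔰)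
    (hloc : ∀ K : Set ℝ, K ⊆ I → IsCompact K →
      IntegrableOn (fun y => 1 / (𝔰 y) ^ 2) K)
    (a : ℝ) (ha : a ≠ 0)
    (𝔣 : ℝ → ℝ) (h𝔣 : ∀ x ∈ I, 𝔣 x = a)
    (c : ℝ) (hc : c ∈ I)
    (x : ℝ) (hx : x ∈ I) :
    (∫ y in c..x, ∫ z in c..y,
        Real.exp (-2 * ∫ u in z..y, 𝔣 u) * ((𝔰 z) ^ 2)⁻¹) =
      (1 / (2 * a)) * ∫ z in c..x, (1 - Real.exp (2 * a * (z - x))) * ((𝔰 z) ^ 2)⁻¹ := by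
  have hsub : uIcc c x ⊆ I := by
    intro y hy
    rw [hI] at hc hx ⊢
    rcases mem_uIcc.1 hy with h | h
    · exact ⟨lt_of_lt_of_le hc.1 (EReal.coe_le_coe_iff.2 h.1),
        lt_of_le_of_lt (EReal.coe_le_coe_iff.2 h.2) hx.2⟩
    · exact ⟨lt_of_lt_of_le hx.1 (EReal.coe_le_coe_iff.2 h.1),
        lt_of_le_of_lt (EReal.coe_le_coe_iff.2 h.2) hc.2⟩
  have hw : IntervalIntegrable (fun z => ((𝔰 z) ^ 2)⁻¹) volume c x := by
    have h := hloc _ hsub isCompact_uIcc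
    simp only [one_div] at h
    exact h.intervalIntegrable
  set w : ℝ → ℝ := fun z => ((𝔰 z) ^ 2)⁻¹ with hwdef
  have hE : Continuous (fun z : ℝ => Real.exp (2 * a * z)) := by fun_prop
  have hew : IntervalIntegrable (fun z => Real.exp (2 * a * z) * w z) volume c x :=
    hw.continuousOn_mul hE.continuousOn
  set G : ℝ → ℝ := fun y => ∫ z in c..y, Real.exp (2 * a * z) * w z with hG
  set g : ℝ → ℝ := fun y => -(1 / (2 * a)) * Real.exp (-(2 * a) * y) with hg
  have hGac : AbsolutelyContinuousOnInterval G c x :=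
    hew.absolutelyContinuousOnInterval_intervalIntegral (by simp)
  have hgac : AbsolutelyContinuousOnInterval g c x := by
    apply ContDiffOn.absolutelyContinuousOnInterval
    apply ContDiff.contDiffOn
    fun_prop
  have hgd : ∀ y, deriv g y = Real.exp (-(2 * a) * y) := by
    intro y
    have h1 : HasDerivAt (fun y : ℝ => -(2 * a) * y) (-(2 * a)) y := by
      simpa using (hasDerivAt_id y).const_mul (-(2 * a))
    have h2 := (h1.exp.const_mul (-(1 / (2 * a)))).deriv
    rw [hg, h2]
    field_simp
  have hL : (∫ y in c..x, ∫ z in c..y,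
        Real.exp (-2 * ∫ u in z..y, 𝔣 u) * ((𝔰 z) ^ 2)⁻¹) = ∫ y in c..x, G y * deriv g y := by
    apply intervalIntegral.integral_congr
    intro y hy
    simp only [hgd, hG]
    rw [← intervalIntegral.integral_mul_const]
    apply intervalIntegral.integral_congr
    intro z hz
    have hz' : z ∈ uIcc c x := uIcc_subset_uIcc left_mem_uIcc hy hz
    have : ∫ u in z..y, 𝔣 u = ∫ u in z..y, a := by
      apply intervalIntegral.integral_congr
      intro u hu
      exact h𝔣 u (hsub (uIcc_subset_uIcc hz' hy hu))
    simp only [this, intervalIntegral.integral_const, smul_eq_mul]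
    rw [show -2 * ((y - z) * a) = 2 * a * z + -(2 * a) * y by ring, Real.exp_add]
    simp only [hwdef]
    ring
  have hR : ∫ y in c..x, deriv G y * g y = ∫ y in c..x, -(1 / (2 * a)) * w y := by
    apply intervalIntegral.integral_congr_ae
    filter_upwards [hew.ae_hasDerivAt_integral] with y hy hy'
    rw [(hy (uIoc_subset_uIcc hy') c (by simp)).deriv]
    have : Real.exp (2 * a * y) * Real.exp (-(2 * a) * y) = 1 := by
      rw [← Real.exp_add]; simp
    simp only [hg]
    linear_combination (-(1 / (2 * a)) * w y) * this
  have hGc : G c = 0 := by simp [hG]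
  have hRHS : ∫ z in c..x, (1 - Real.exp (2 * a * (z - x))) * w z
      = (∫ z in c..x, w z) - G x * Real.exp (-(2 * a) * x) := by
    simp only [hG]
    rw [← intervalIntegral.integral_mul_const, ← intervalIntegral.integral_sub hw
      (hew.mul_const _)]
    apply intervalIntegral.integral_congr
    intro z _
    simp only []
    rw [show 2 * a * (z - x) = 2 * a * z + -(2 * a) * x by ring, Real.exp_add]
    ring
  rw [hL, hGac.integral_mul_deriv_eq_deriv_mul hgac, hR, hRHS, hGc,
    intervalIntegral.integral_const_mul]
  simp only [hg]
  ring
end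

section
/- Let I ⊆ (0,∞) be an open interval, let 𝔰 : I → ℝ∖{0} be Borel measurable with 1/𝔰² locally integrable on I, let a ∈ ℝ∖{1/2}, and suppose 𝔟(x) = a·𝔰(x)/x for all x ∈ I (so 𝔣(x) = a/x). Then for every x ∈ I the Feller test function satisfies v(x) = (1/(1-2a)) ∫_c^x ( x·(z/x)^{2a} - z ) · 𝔰(z)^{-2} dz. -/
open MeasureTheory intervalIntegral Set

/-- **Feller test function for `𝔟(x) = a·𝔰(x)/x`.**
If `I = (ℓ, r) ⊆ (0,∞)` is an open interval, `𝔰 ≠ 0` is Borel measurable with `1/𝔰²`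
locally integrable, `a ≠ 1/2`, and the mean/variance ratio is `𝔣(x) = a/x` (i.e. the
drift is `𝔟(x) = a·𝔰(x)/x`), then the Feller test function satisfies
`v(x) = (1/(1-2a)) ∫_c^x (x·(z/x)^{2a} - z) 𝔰(z)⁻² dz` for every `x ∈ I`. -/
theorem feller_test_function_drift_a_over_x
    (ℓ r : EReal) (hlr : ℓ < r) (hℓ : (0 : EReal) ≤ ℓ)
    (I : Set ℝ) (hI : I = {x : ℝ | ℓ < (x : EReal) ∧ (x : EReal) < r})
    (𝔰 : ℝ → ℝ)
    (h𝔰 : ∀ x ∈ I, 𝔰 x ≠ 0)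
    (h𝔰meas : Measurable 𝔰)
    (hloc : ∀ K : Set ℝ, K ⊆ I → IsCompact K →
      IntegrableOn (fun y => 1 / (𝔰 y) ^ 2) K)
    (a : ℝ) (ha : a ≠ 1 / 2)
    (𝔣 : ℝ → ℝ) (h𝔣 : ∀ x ∈ I, 𝔣 x = a / x)
    (c : ℝ) (hc : c ∈ I)
    (x : ℝ) (hx : x ∈ I) :
    (∫ y in c..x, ∫ z in c..y,
        Real.exp (-2 * ∫ u in z..y, 𝔣 u) * ((𝔰 z) ^ 2)⁻¹) =
      (1 / (1 - 2 * a)) *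
        ∫ z in c..x, (x * (z / x) ^ (2 * a) - z) * ((𝔰 z) ^ 2)⁻¹ := by
  have hpos : ∀ t ∈ I, 0 < t := by
    intro t ht
    rw [hI] at ht
    exact_mod_cast lt_of_le_of_lt hℓ ht.1
  have hsub : ∀ p ∈ I, ∀ q ∈ I, uIcc p q ⊆ I := by
    intro p hp q hq
    have : I.OrdConnected := by
      rw [hI]
      refine ⟨fun u hu v hv w hw => ⟨lt_of_lt_of_le hu.1 ?_, lt_of_le_of_lt ?_ hv.2⟩⟩
      · exact_mod_cast hw.1
      · exact_mod_cast hw.2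
    exact this.uIcc_subset hp hq
  have hcx := hsub c hc x hx
  have hx0 := hpos x hx
  have hne : 1 - 2 * a ≠ 0 := by
    intro h
    apply ha
    linarith
  -- the exponential
  have hexp : ∀ z ∈ I, ∀ y ∈ I,
      Real.exp (-2 * ∫ u in z..y, 𝔣 u) = y ^ (-(2 * a)) * z ^ (2 * a) := by
    intro z hz y hy
    have hz0 := hpos z hz
    have hy0 := hpos y hy
    have h1 : ∫ u in z..y, 𝔣 u = a * Real.log (y / z) := by
      rw [← integral_inv_of_pos hz0 hy0, ← intervalIntegral.integral_const_mul]
      apply intervalIntegral.integral_congr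
      intro u hu
      simp only
      rw [h𝔣 u (hsub z hz y hy hu), div_eq_mul_inv]
    rw [h1, Real.rpow_def_of_pos hy0, Real.rpow_def_of_pos hz0, ← Real.exp_add,
      Real.log_div hy0.ne' hz0.ne']
    congr 1
    ring
  set w : ℝ → ℝ := fun z => ((𝔰 z) ^ 2)⁻¹ with hw
  have hwint : IntervalIntegrable w volume c x := by
    have := hloc (uIcc c x) hcx isCompact_uIcc
    simp only [one_div] at this
    exact this.intervalIntegrable
  have hcont : ∀ p : ℝ, ContinuousOn (fun z : ℝ => z ^ p) (uIcc c x) := fun p z hz =>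
    (Real.continuousAt_rpow_const z p (Or.inl (hpos z (hcx hz)).ne')).continuousWithinAt
  set g : ℝ → ℝ := fun z => z ^ (2 * a) * w z with hg
  have hgint : IntervalIntegrable g volume c x := hwint.continuousOn_mul (hcont (2 * a))
  set G : ℝ → ℝ := fun y => ∫ z in c..y, g z with hG
  have hGac : AbsolutelyContinuousOnInterval G c x :=
    hgint.absolutelyContinuousOnInterval_intervalIntegral (by simp)
  set F : ℝ → ℝ := fun y => y ^ (1 - 2 * a) / (1 - 2 * a) with hF
  have hFd : ∀ y ∈ uIcc c x, HasDerivAt F (y ^ (-(2 * a))) y := by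
    intro y hy
    have := (Real.hasDerivAt_rpow_const (x := y) (p := 1 - 2 * a)
      (Or.inl (hpos y (hcx hy)).ne')).div_const (1 - 2 * a)
    rw [mul_div_cancel_left₀ _ hne, show 1 - 2 * a - 1 = -(2 * a) by ring] at this
    exact this
  have hFac : AbsolutelyContinuousOnInterval F c x := by
    apply ContDiffOn.absolutelyContinuousOnInterval
    intro y hy
    exact ((Real.contDiffAt_rpow_const_of_ne (hpos y (hcx hy)).ne').div_const _).contDiffWithinAt
  have hparts := hFac.integral_mul_deriv_eq_deriv_mul hGac
  have e1 : (∫ y in c..x, F y * deriv G y) = ∫ y in c..x, F y * g y := by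
    apply intervalIntegral.integral_congr_ae
    filter_upwards [hgint.ae_hasDerivAt_integral] with y hy hyc
    rw [(hy (uIoc_subset_uIcc hyc) c (by simp)).deriv]
  have e2 : (∫ y in c..x, deriv F y * G y) = ∫ y in c..x, ∫ z in c..y,
      Real.exp (-2 * ∫ u in z..y, 𝔣 u) * w z := by
    apply intervalIntegral.integral_congr
    intro y hy
    simp only
    rw [(hFd y hy).deriv, hG, ← intervalIntegral.integral_const_mul]
    apply intervalIntegral.integral_congr
    intro z hz
    simp only [hg]
    rw [hexp z (hsub c hc y (hcx hy) hz) y (hcx hy)]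
    ring
  have e3 : (∫ z in c..x, (x * (z / x) ^ (2 * a) - z) * w z) =
      x ^ (1 - 2 * a) * G x - (1 - 2 * a) * ∫ y in c..x, F y * g y := by
    rw [hG, ← intervalIntegral.integral_const_mul, ← intervalIntegral.integral_const_mul,
      ← intervalIntegral.integral_sub (hgint.const_mul _)
        ((hgint.continuousOn_mul hFac.continuousOn).const_mul _)]
    apply intervalIntegral.integral_congr
    intro z hz
    have hz0 := hpos z (hcx hz)
    simp only [hg, hF]
    have a1 : x * (z / x) ^ (2 * a) = x ^ (1 - 2 * a) * z ^ (2 * a) := by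
      rw [Real.div_rpow hz0.le hx0.le, Real.rpow_sub hx0, Real.rpow_one]
      ring
    have a2 : z ^ (1 - 2 * a) * z ^ (2 * a) = z := by
      rw [← Real.rpow_add hz0]
      simp
    rw [a1]
    field_simp
    linear_combination (w z) * a2
  have hGc : G c = 0 := by simp [hG]
  rw [e1, e2, hGc] at hparts
  rw [e3]
  have hFx : F x = x ^ (1 - 2 * a) / (1 - 2 * a) := rfl
  rw [hFx] at hparts
  have hfin : (∫ y in c..x, ∫ z in c..y, Real.exp (-2 * ∫ u in z..y, 𝔣 u) * w z) =
    x ^ (1 - 2 * a) / (1 - 2 * a) * G x - ∫ y in c..x, F y * g y := by linarith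
  rw [hfin]
  field_simp
end

section
/- Let 𝔰 : (0,∞) → ℝ∖{0} be Borel measurable with 1/𝔰² locally integrable on (0,∞), and define v(x) = ∫_1^x (x - z) · 𝔰(z)^{-2} dz for x ∈ (0,∞) (this is the Feller test function for 𝔟 ≡ 0 with c = 1). Then: (a) lim_{x↓0} v(x) = ∞ holds if and only if ∫_0^1 z · 𝔰(z)^{-2} dz = ∞; and (b) lim_{x→∞} v(x) = ∞ holds unconditionally. -/
open MeasureTheory intervalIntegral Set Filter

/-- **Explosion condition for driftless diffusions on `(0,∞)` (Proposition, part (ii)).**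
Let `𝔰 ≠ 0` be Borel measurable on `(0,∞)` with `1/𝔰²` locally integrable, and let
`v(x) = ∫_1^x (x - z) 𝔰(z)⁻² dz` be the Feller test function for zero drift and `c = 1`.
Then (a) `v(0+) = ∞` if and only if `∫_0^1 z·𝔰(z)⁻² dz = ∞`, and
(b) `v(∞) = ∞` always holds. -/
theorem feller_boundary_test_driftless
    (𝔰 : ℝ → ℝ)
    (h𝔰 : ∀ x ∈ Set.Ioi (0 : ℝ), 𝔰 x ≠ 0)
    (h𝔰meas : Measurable 𝔰)
    (hloc : ∀ K : Set ℝ, K ⊆ Set.Ioi (0 : ℝ) → IsCompact K →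
      IntegrableOn (fun z => 1 / (𝔰 z) ^ 2) K)
    (v : ℝ → ℝ)
    (hv : ∀ x ∈ Set.Ioi (0 : ℝ), v x = ∫ z in (1 : ℝ)..x, (x - z) * ((𝔰 z) ^ 2)⁻¹) :
    (Tendsto v (nhdsWithin 0 (Set.Ioi 0)) atTop ↔
      ∫⁻ z in Set.Ioc (0 : ℝ) 1, ENNReal.ofReal (z * ((𝔰 z) ^ 2)⁻¹) = ⊤) ∧
    Tendsto v atTop atTop := by
  have hg0 : ∀ z, 0 ≤ ((𝔰 z) ^ 2)⁻¹ := fun z => by positivity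
  have hgm : Measurable (fun z => ((𝔰 z) ^ 2)⁻¹) := (h𝔰meas.pow_const 2).inv
  have hgi : ∀ a b : ℝ, 0 < a → IntegrableOn (fun z => ((𝔰 z) ^ 2)⁻¹) (Set.Icc a b) := by
    intro a b ha
    have := hloc (Set.Icc a b) (fun z hz => lt_of_lt_of_le ha hz.1) isCompact_Icc
    simpa only [one_div] using this
  have hwi : ∀ x a b : ℝ, 0 < a →
      IntegrableOn (fun z => (x - z) * ((𝔰 z) ^ 2)⁻¹) (Set.Icc a b) := by
    intro x a b ha
    exact (hgi a b ha).continuousOn_mul (by fun_prop) isCompact_Icc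
  have key : ∀ x : ℝ, 0 < x → x ≤ 1 → 0 ≤ v x ∧ ENNReal.ofReal (v x) =
      ∫⁻ z in Set.Ioc (0 : ℝ) 1, ENNReal.ofReal ((z - x) * ((𝔰 z) ^ 2)⁻¹) := by
    intro x hx hx1
    have e : v x = ∫ z in Set.Ioc x 1, (z - x) * ((𝔰 z) ^ 2)⁻¹ := by
      rw [hv x hx, intervalIntegral.integral_symm, intervalIntegral.integral_of_le hx1,
        ← MeasureTheory.integral_neg]
      congr 1; ext z; ring
    have hnn : ∀ z ∈ Set.Ioc x 1, 0 ≤ (z - x) * ((𝔰 z) ^ 2)⁻¹ := fun z hz =>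
      mul_nonneg (by linarith [hz.1]) (hg0 z)
    have hint : IntegrableOn (fun z => (z - x) * ((𝔰 z) ^ 2)⁻¹) (Set.Ioc x 1) := by
      have h := ((hwi x x 1 hx).mono_set Set.Ioc_subset_Icc_self).neg
      refine h.congr (Filter.Eventually.of_forall fun z => ?_)
      simp only [Pi.neg_apply]; ring
    refine ⟨e ▸ setIntegral_nonneg measurableSet_Ioc hnn, ?_⟩
    rw [e, ofReal_integral_eq_lintegral_ofReal hint
      ((ae_restrict_iff' measurableSet_Ioc).2 (Filter.Eventually.of_forall hnn))]
    have hU : Set.Ioc (0:ℝ) 1 = Set.Ioc 0 x ∪ Set.Ioc x 1 := (Set.Ioc_union_Ioc_eq_Ioc hx.le hx1).symm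
    have hz : ∫⁻ z in Set.Ioc 0 x, ENNReal.ofReal ((z - x) * ((𝔰 z) ^ 2)⁻¹) = 0 := by
      rw [setLIntegral_congr_fun (g := fun _ => 0) measurableSet_Ioc]
      · simp
      · intro z hz
        exact ENNReal.ofReal_of_nonpos
          (mul_nonpos_of_nonpos_of_nonneg (by linarith [hz.2]) (hg0 z))
    rw [hU, lintegral_union measurableSet_Ioc (Set.Ioc_disjoint_Ioc_of_le le_rfl), hz, zero_add]
  have hmono : ∀ x y : ℝ, 0 < x → x ≤ y → y ≤ 1 → v y ≤ v x := by
    intro x y hx hxy hy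
    rw [← ENNReal.ofReal_le_ofReal_iff (key x hx (hxy.trans hy)).1,
      (key x hx (hxy.trans hy)).2, (key y (hx.trans_le hxy) hy).2]
    refine lintegral_mono fun z => ENNReal.ofReal_le_ofReal ?_
    exact mul_le_mul_of_nonneg_right (by linarith) (hg0 z)
  refine ⟨⟨fun h => ?_, fun h => ?_⟩, ?_⟩
  · by_contra hL
    have h1 := h.eventually_gt_atTop
      (∫⁻ z in Set.Ioc (0 : ℝ) 1, ENNReal.ofReal (z * ((𝔰 z) ^ 2)⁻¹)).toReal
    have h2 : ∀ᶠ x : ℝ in nhdsWithin 0 (Set.Ioi 0), x ∈ Set.Ioo (0:ℝ) 1 :=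
      Ioo_mem_nhdsGT one_pos
    obtain ⟨x, hx, hx0, hx1⟩ := (h1.and h2).exists
    obtain ⟨k0, k⟩ := key x hx0 hx1.le
    refine absurd hx (not_lt.2 ?_)
    rw [← ENNReal.ofReal_le_iff_le_toReal hL, k]
    refine lintegral_mono fun z => ENNReal.ofReal_le_ofReal ?_
    exact mul_le_mul_of_nonneg_right (by linarith) (hg0 z)
  · have ht : Tendsto (fun n : ℕ => 1 / ((n:ℝ) + 1)) atTop (nhds 0) :=
      tendsto_one_div_add_atTop_nhds_zero_nat
    have hlim : Tendsto (fun n : ℕ => ∫⁻ z in Set.Ioc (0 : ℝ) 1,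
        ENNReal.ofReal ((z - 1 / ((n:ℝ) + 1)) * ((𝔰 z) ^ 2)⁻¹)) atTop
        (nhds (∫⁻ z in Set.Ioc (0 : ℝ) 1, ENNReal.ofReal (z * ((𝔰 z) ^ 2)⁻¹))) := by
      apply lintegral_tendsto_of_tendsto_of_monotone
      · intro n
        exact (((measurable_id.sub_const _).mul hgm).ennreal_ofReal).aemeasurable
      · refine Filter.Eventually.of_forall fun z n m hnm => ENNReal.ofReal_le_ofReal ?_
        refine mul_le_mul_of_nonneg_right ?_ (hg0 z)
        have := Nat.one_div_le_one_div (α := ℝ) hnm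
        linarith
      · refine Filter.Eventually.of_forall fun z => ENNReal.tendsto_ofReal ?_
        have := (ht.const_sub z).mul_const (((𝔰 z) ^ 2)⁻¹)
        simpa using this
    rw [h] at hlim
    refine tendsto_atTop.2 fun M => ?_
    obtain ⟨n, hn⟩ := (hlim.eventually (lt_mem_nhds (ENNReal.ofReal_lt_top (r := M)))).exists
    have hp : 0 < 1 / ((n:ℝ) + 1) := by positivity
    have hp1 : 1 / ((n:ℝ) + 1) ≤ 1 := by
      rw [div_le_one (by positivity)]; linarith [(Nat.cast_nonneg n : (0:ℝ) ≤ n)]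
    rw [← (key _ hp hp1).2] at hn
    have hM : M ≤ v (1 / ((n:ℝ) + 1)) :=
      (ENNReal.ofReal_le_ofReal_iff (key _ hp hp1).1).1 hn.le
    have h2 : ∀ᶠ x : ℝ in nhdsWithin 0 (Set.Ioi 0), x ∈ Set.Ioo (0:ℝ) (1 / ((n:ℝ) + 1)) :=
      Ioo_mem_nhdsGT hp
    filter_upwards [h2] with x hx
    exact hM.trans (hmono x _ hx.1 hx.2.le hp1)
  · have hI : IntervalIntegrable (fun z => ((𝔰 z) ^ 2)⁻¹) volume 1 2 :=
      (intervalIntegrable_iff_integrableOn_Icc_of_le one_le_two).2 (hgi 1 2 one_pos)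
    have hc : 0 < ∫ z in (1:ℝ)..2, ((𝔰 z) ^ 2)⁻¹ := by
      refine intervalIntegral.intervalIntegral_pos_of_pos_on hI ?_ one_lt_two
      intro z hz
      have := h𝔰 z (lt_trans one_pos hz.1)
      positivity
    have hb : Tendsto (fun x : ℝ => (x - 2) * ∫ z in (1:ℝ)..2, ((𝔰 z) ^ 2)⁻¹) atTop atTop :=
      (tendsto_atTop_add_const_right atTop (-2) tendsto_id).atTop_mul_const hc
    refine tendsto_atTop_mono' atTop ?_ hb
    filter_upwards [eventually_ge_atTop (2:ℝ)] with x hx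
    have hJ : ∀ a b : ℝ, 0 < a → a ≤ b →
        IntervalIntegrable (fun z => (x - z) * ((𝔰 z) ^ 2)⁻¹) volume a b := fun a b ha hab =>
      (intervalIntegrable_iff_integrableOn_Icc_of_le hab).2 (hwi x a b ha)
    rw [hv x (by simp only [Set.mem_Ioi]; linarith),
      ← intervalIntegral.integral_add_adjacent_intervals (hJ 1 2 one_pos one_le_two)
        (hJ 2 x two_pos hx), ← intervalIntegral.integral_const_mul]
    have a1 : ∫ z in (1:ℝ)..2, (x - 2) * ((𝔰 z) ^ 2)⁻¹ ≤
        ∫ z in (1:ℝ)..2, (x - z) * ((𝔰 z) ^ 2)⁻¹ := by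
      refine intervalIntegral.integral_mono_on one_le_two (hI.const_mul _)
        (hJ 1 2 one_pos one_le_two) fun z hz => ?_
      exact mul_le_mul_of_nonneg_right (by linarith [hz.2]) (hg0 z)
    have a2 : 0 ≤ ∫ z in (2:ℝ)..x, (x - z) * ((𝔰 z) ^ 2)⁻¹ :=
      intervalIntegral.integral_nonneg hx fun z hz =>
        mul_nonneg (by linarith [hz.2]) (hg0 z)
    linarith
end

section
/- Let 𝔰 : (0,∞) → ℝ∖{0} be Borel measurable with 1/𝔰² locally integrable on (0,∞), and define v(x) = ∫_1^x ( z - z²/x ) · 𝔰(z)^{-2} dz for x ∈ (0,∞) (this is the Feller test function for 𝔟(x) = 𝔰(x)/x with c = 1). Then: (a) lim_{x→∞} v(x) = ∞ holds if and only if ∫_1^∞ z · 𝔰(z)^{-2} dz = ∞; and (b) lim_{x↓0} v(x) = ∞ holds unconditionally. -/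
open MeasureTheory intervalIntegral Set Filter

/-- **Explosion condition for the drift `𝔟(x) = 𝔰(x)/x` on `(0,∞)` (Proposition, part (iii)).**
Let `𝔰 ≠ 0` be Borel measurable on `(0,∞)` with `1/𝔰²` locally integrable, and let
`v(x) = ∫_1^x (z - z²/x) 𝔰(z)⁻² dz` be the Feller test function for the drift
`𝔟(x) = 𝔰(x)/x` and `c = 1`. Then (a) `v(∞) = ∞` if and only if
`∫_1^∞ z·𝔰(z)⁻² dz = ∞`, and (b) `v(0+) = ∞` always holds. -/
theorem feller_boundary_test_h_transform
    (𝔰 : ℝ → ℝ)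
    (h𝔰 : ∀ x ∈ Set.Ioi (0 : ℝ), 𝔰 x ≠ 0)
    (h𝔰meas : Measurable 𝔰)
    (hloc : ∀ K : Set ℝ, K ⊆ Set.Ioi (0 : ℝ) → IsCompact K →
      IntegrableOn (fun z => 1 / (𝔰 z) ^ 2) K)
    (v : ℝ → ℝ)
    (hv : ∀ x ∈ Set.Ioi (0 : ℝ), v x = ∫ z in (1 : ℝ)..x, (z - z ^ 2 / x) * ((𝔰 z) ^ 2)⁻¹) :
    (Tendsto v atTop atTop ↔
      ∫⁻ z in Set.Ioi (1 : ℝ), ENNReal.ofReal (z * ((𝔰 z) ^ 2)⁻¹) = ⊤) ∧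
    Tendsto v (nhdsWithin 0 (Set.Ioi 0)) atTop := by
  set w : ℝ → ℝ := fun z => ((𝔰 z) ^ 2)⁻¹ with hw
  have hwm : Measurable w := (h𝔰meas.pow_const 2).inv
  have hw0 : ∀ z, 0 ≤ w z := fun z => inv_nonneg.mpr (sq_nonneg _)
  have hwp : ∀ z, 0 < z → 0 < w z := fun z hz => by
    have := h𝔰 z hz
    simp only [hw]
    positivity
  have W : ∀ a b : ℝ, 0 < a → 0 < b → IntervalIntegrable w volume a b := by
    intro a b ha hb
    have h := hloc (Set.uIcc a b) (fun z hz => lt_of_lt_of_le (lt_min ha hb) hz.1) isCompact_uIcc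
    have h2 : IntegrableOn w (Set.uIcc a b) := by
      simpa only [one_div] using h
    exact h2.intervalIntegrable
  have WF : ∀ (f : ℝ → ℝ), Continuous f → ∀ a b : ℝ, 0 < a → 0 < b →
      IntervalIntegrable (fun z => f z * w z) volume a b := by
    intro f hf a b ha hb
    exact (W a b ha hb).continuousOn_mul hf.continuousOn
  have hv' : ∀ x, 0 < x → v x = ∫ z in (1 : ℝ)..x, (z - z ^ 2 / x) * w z := fun x hx => hv x hx
  have WG : ∀ a b : ℝ, 0 < a → 0 < b → IntervalIntegrable (fun z => z * w z) volume a b :=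
    WF (fun z => z) continuous_id
  have WV : ∀ x a b : ℝ, 0 < a → 0 < b →
      IntervalIntegrable (fun z => (z - z ^ 2 / x) * w z) volume a b := fun x =>
    WF (fun z => z - z ^ 2 / x) (by fun_prop)
  have hgm : Measurable (fun z => z * w z) := measurable_id.mul hwm
  have hg0 : ∀ z ∈ Set.Ioi (1 : ℝ), 0 ≤ z * w z := fun z hz =>
    mul_nonneg (by linarith [Set.mem_Ioi.mp hz]) (hw0 z)
  refine ⟨⟨?_, ?_⟩, ?_⟩
  · intro ht
    by_contra hne
    have hint : IntegrableOn (fun z => z * w z) (Set.Ioi 1) := by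
      refine ⟨hgm.aestronglyMeasurable, ?_⟩
      rw [hasFiniteIntegral_iff_ofReal]
      · exact lt_top_iff_ne_top.mpr hne
      · exact (ae_restrict_mem measurableSet_Ioi).mono hg0
    obtain ⟨x, hx, hx1⟩ := ((ht.eventually_gt_atTop (∫ z in Set.Ioi (1:ℝ), z * w z)).and
      (eventually_ge_atTop (1:ℝ))).exists
    have hx0 : 0 < x := by linarith
    rw [hv' x hx0] at hx
    have h1 : ∫ z in (1 : ℝ)..x, (z - z ^ 2 / x) * w z ≤ ∫ z in (1 : ℝ)..x, z * w z := by
      refine intervalIntegral.integral_mono_on hx1 (WV x 1 x one_pos hx0) (WG 1 x one_pos hx0) ?_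
      intro z hz
      refine mul_le_mul_of_nonneg_right ?_ (hw0 z)
      have : 0 ≤ z ^ 2 / x := by positivity
      linarith
    have h2 : ∫ z in (1 : ℝ)..x, z * w z ≤ ∫ z in Set.Ioi (1:ℝ), z * w z := by
      rw [intervalIntegral.integral_of_le hx1]
      refine setIntegral_mono_set hint ?_ ?_
      · exact (ae_restrict_mem measurableSet_Ioi).mono hg0
      · exact Eventually.of_forall (fun z hz => hz.1)
    linarith
  · intro htop
    have hunb : ∀ M : ℝ, ∃ y, 1 ≤ y ∧ M < ∫ z in (1 : ℝ)..y, z * w z := by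
      intro M
      by_contra! hcon
      have hint : IntegrableOn (fun z => z * w z) (Set.Ioi 1) := by
        refine integrableOn_Ioi_of_intervalIntegral_norm_bounded (l := atTop) (b := fun x : ℝ => x)
          M 1 ?_ tendsto_id ?_
        · intro i
          rcases le_total 1 i with h | h
          · exact (WG 1 i one_pos (by linarith)).1
          · simp [Set.Ioc_eq_empty_of_le h]
        · filter_upwards [eventually_ge_atTop (1:ℝ)] with y hy
          refine le_trans (le_of_eq ?_) (hcon y hy)
          refine intervalIntegral.integral_congr ?_
          intro z hz
          rw [Set.uIcc_of_le hy] at hz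
          exact Real.norm_of_nonneg (mul_nonneg (by linarith [hz.1]) (hw0 z))
      have h2 := hint.2
      rw [hasFiniteIntegral_iff_ofReal ((ae_restrict_mem measurableSet_Ioi).mono hg0)] at h2
      exact h2.ne htop
    rw [tendsto_atTop]
    intro M
    obtain ⟨y, hy1, hy⟩ := hunb (2 * M)
    filter_upwards [eventually_ge_atTop (2 * y)] with x hx
    have hx0 : 0 < x := by linarith
    have hy0 : 0 < y := by linarith
    rw [hv' x hx0, ← intervalIntegral.integral_add_adjacent_intervals
      (WV x 1 y one_pos hy0) (WV x y x hy0 hx0)]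
    have h1 : 0 ≤ ∫ z in y..x, (z - z ^ 2 / x) * w z := by
      refine intervalIntegral.integral_nonneg (by linarith) ?_
      intro z hz
      refine mul_nonneg ?_ (hw0 z)
      rw [sub_nonneg, div_le_iff₀ hx0]
      nlinarith [hz.1, hz.2]
    have h2 : ∫ z in (1:ℝ)..y, (1/2) * (z * w z) ≤ ∫ z in (1:ℝ)..y, (z - z ^ 2 / x) * w z := by
      refine intervalIntegral.integral_mono_on hy1 ((WG 1 y one_pos hy0).const_mul _)
        (WV x 1 y one_pos hy0) ?_
      intro z hz
      rw [← mul_assoc]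
      refine mul_le_mul_of_nonneg_right ?_ (hw0 z)
      have : z ^ 2 / x ≤ z / 2 := by
        rw [div_le_iff₀ hx0]
        nlinarith [hz.1, hz.2]
      linarith
    rw [intervalIntegral.integral_const_mul] at h2
    linarith
  · have hC : 0 < ∫ z in (1/2:ℝ)..1, w z := by
      refine intervalIntegral.intervalIntegral_pos_of_pos_on (W _ _ (by norm_num) one_pos) ?_
        (by norm_num)
      intro z hz
      exact hwp z (by linarith [hz.1])
    set C := ∫ z in (1/2:ℝ)..1, w z with hCdef
    have key : Tendsto (fun x : ℝ => x⁻¹ * (C / 8)) (nhdsWithin 0 (Set.Ioi 0)) atTop :=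
      tendsto_inv_nhdsGT_zero.atTop_mul_const (by positivity)
    refine tendsto_atTop_mono' _ ?_ key
    have hlt : ∀ᶠ x : ℝ in nhdsWithin 0 (Set.Ioi 0), x < 1/4 :=
      nhdsWithin_le_nhds (Iio_mem_nhds (by norm_num))
    filter_upwards [hlt, self_mem_nhdsWithin] with x hx hx0
    have hx0 : 0 < x := hx0
    have hneg : v x = (∫ z in x..(1/2:ℝ), (z ^ 2 / x - z) * w z)
        + ∫ z in (1/2:ℝ)..1, (z ^ 2 / x - z) * w z := by
      rw [intervalIntegral.integral_add_adjacent_intervals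
        (WF (fun z => z ^ 2 / x - z) (by fun_prop) _ _ hx0 (by norm_num))
        (WF (fun z => z ^ 2 / x - z) (by fun_prop) _ _ (by norm_num) one_pos),
        hv' x hx0, intervalIntegral.integral_symm, ← intervalIntegral.integral_neg]
      congr 1
      ext z
      ring
    rw [hneg]
    have h1 : 0 ≤ ∫ z in x..(1/2:ℝ), (z ^ 2 / x - z) * w z := by
      refine intervalIntegral.integral_nonneg (by linarith) ?_
      intro z hz
      refine mul_nonneg ?_ (hw0 z)
      rw [sub_nonneg, le_div_iff₀ hx0]
      nlinarith [hz.1, hz.2]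
    have h2 : ∫ z in (1/2:ℝ)..1, (x⁻¹ / 8) * w z ≤ ∫ z in (1/2:ℝ)..1, (z ^ 2 / x - z) * w z := by
      refine intervalIntegral.integral_mono_on (by norm_num)
        ((W _ _ (by norm_num) one_pos).const_mul _)
        (WF (fun z => z ^ 2 / x - z) (by fun_prop) _ _ (by norm_num) one_pos) ?_
      intro z hz
      refine mul_le_mul_of_nonneg_right ?_ (hw0 z)
      have e : z ^ 2 / x - z - x⁻¹ / 8 = (z ^ 2 - z * x - 1 / 8) / x := by
        field_simp
      have : 0 ≤ (z ^ 2 - z * x - 1 / 8) / x := by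
        refine div_nonneg ?_ hx0.le
        nlinarith [hz.1, hz.2]
      linarith
    rw [intervalIntegral.integral_const_mul, ← hCdef] at h2
    have : x⁻¹ * (C / 8) = x⁻¹ / 8 * C := by ring
    linarith
end

section
/- Let I = (ℓ,r) be an open interval and 𝔰, 𝔟 : I → ℝ. Call a function 𝒰 : [0,∞) × I → ℝ a classical solution of the Cauchy problem if 𝒰 is continuous on [0,∞) × I, possesses on (0,∞) × I continuous partial derivatives ∂_τ𝒰, ∂_x𝒰, ∂²_x𝒰 satisfying ∂_τ𝒰(τ,x) = (𝔰²(x)/2)·∂²_x𝒰(τ,x) + 𝔟(x)𝔰(x)·∂_x𝒰(τ,x) for all (τ,x) ∈ (0,∞) × I, and 𝒰(0,x) = 1 for all x ∈ I. Assume that every nonnegative classical solution 𝒰 of the Cauchy problem satisfies 𝒰(τ,x) ≥ 1 for all (τ,x) (i.e., the constant function 1 is the smallest nonnegative classical solution). Then every bounded classical solution V of the Cauchy problem satisfies V(τ,x) = 1 for all (τ,x) ∈ [0,∞) × I. -/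
open Set Filter

/-- `U : [0,∞) × I → ℝ` is a classical solution of the Cauchy problem
`∂_τ U = (𝔰²/2) ∂²_x U + 𝔟 𝔰 ∂_x U` on `(0,∞) × I` with initial condition `U(0,·) ≡ 1`:
`U` is continuous on `[0,∞) × I`, possesses continuous partial derivatives
`∂_τ U, ∂_x U, ∂²_x U` on `(0,∞) × I` satisfying the parabolic equation there, and
`U(0,x) = 1` for all `x ∈ I`. -/
def IsClassicalSolCauchy (I : Set ℝ) (𝔰 𝔟 : ℝ → ℝ) (U : ℝ → ℝ → ℝ) : Prop :=
  ContinuousOn (fun p : ℝ × ℝ => U p.1 p.2) (Set.Ici 0 ×ˢ I) ∧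
  (∀ x ∈ I, U 0 x = 1) ∧
  ∃ Uτ Ux Uxx : ℝ → ℝ → ℝ,
    ContinuousOn (fun p : ℝ × ℝ => Uτ p.1 p.2) (Set.Ioi 0 ×ˢ I) ∧
    ContinuousOn (fun p : ℝ × ℝ => Ux p.1 p.2) (Set.Ioi 0 ×ˢ I) ∧
    ContinuousOn (fun p : ℝ × ℝ => Uxx p.1 p.2) (Set.Ioi 0 ×ˢ I) ∧
    ∀ τ ∈ Set.Ioi (0 : ℝ), ∀ x ∈ I,
      HasDerivAt (fun t => U t x) (Uτ τ x) τ ∧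
      HasDerivAt (fun y => U τ y) (Ux τ x) x ∧
      HasDerivAt (fun y => Ux τ y) (Uxx τ x) x ∧
      Uτ τ x = (𝔰 x) ^ 2 / 2 * Uxx τ x + 𝔟 x * 𝔰 x * Ux τ x

/-- **Unique bounded solution of the Cauchy problem (Proposition 4.6).**
Let `I = (ℓ, r)` and `𝔰, 𝔟 : I → ℝ`. Assume the constant function `1` is the smallest
nonnegative classical solution of the Cauchy problem, i.e. every nonnegative classical
solution dominates `1` on `[0,∞) × I`. Then every bounded classical solution `V` of the
Cauchy problem equals `1` on `[0,∞) × I`. -/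
theorem cauchy_problem_unique_bounded_solution
    (ℓ r : EReal) (hlr : ℓ < r)
    (I : Set ℝ) (hI : I = {x : ℝ | ℓ < (x : EReal) ∧ (x : EReal) < r})
    (𝔰 𝔟 : ℝ → ℝ)
    (hmin : ∀ U : ℝ → ℝ → ℝ, IsClassicalSolCauchy I 𝔰 𝔟 U →
      (∀ τ ∈ Set.Ici (0 : ℝ), ∀ x ∈ I, 0 ≤ U τ x) →
      ∀ τ ∈ Set.Ici (0 : ℝ), ∀ x ∈ I, 1 ≤ U τ x)
    (V : ℝ → ℝ → ℝ) (hV : IsClassicalSolCauchy I 𝔰 𝔟 V)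
    (hVbdd : ∃ K : ℝ, ∀ τ ∈ Set.Ici (0 : ℝ), ∀ x ∈ I, |V τ x| ≤ K) :
    ∀ τ ∈ Set.Ici (0 : ℝ), ∀ x ∈ I, V τ x = 1 := by
  obtain ⟨K, hK⟩ := hVbdd
  obtain ⟨hc, h0, Uτ, Ux, Uxx, h1, h2, h3, h4⟩ := hV
  have key : ∀ c : ℝ, |c| * (|K| + 1) ≤ 1 →
      ∀ τ ∈ Set.Ici (0 : ℝ), ∀ x ∈ I, 0 ≤ c * (V τ x - 1) := by
    intro c hcK τ hτ x hx
    have := hmin (fun t y => 1 + c * (V t y - 1)) ?_ ?_ τ hτ x hx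
    · have := this
      linarith
    · refine ⟨?_, ?_, fun t y => c * Uτ t y, fun t y => c * Ux t y, fun t y => c * Uxx t y,
        ?_, ?_, ?_, ?_⟩
      · exact continuousOn_const.add (continuousOn_const.mul (hc.sub continuousOn_const))
      · intro y hy
        simp [h0 y hy]
      · exact continuousOn_const.mul h1
      · exact continuousOn_const.mul h2
      · exact continuousOn_const.mul h3
      · intro t ht y hy
        obtain ⟨a1, a2, a3, a4⟩ := h4 t ht y hy
        refine ⟨((a1.sub_const 1).const_mul c).const_add 1,
          ((a2.sub_const 1).const_mul c).const_add 1, a3.const_mul c, ?_⟩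
        simp only [a4]
        ring
    · intro t ht y hy
      have hb : |V t y - 1| ≤ |K| + 1 := by
        have e1 := abs_le.mp ((hK t ht y hy).trans (le_abs_self K))
        rw [abs_le]
        constructor <;> linarith [e1.1, e1.2]
      have h5 : |c * (V t y - 1)| ≤ 1 := by
        rw [abs_mul]
        exact (mul_le_mul_of_nonneg_left hb (abs_nonneg c)).trans hcK
      have := (abs_le.mp h5).1
      linarith
  intro τ hτ x hx
  have hp : 0 < |K| + 1 := by positivity
  have hq : |(|K| + 1)⁻¹| * (|K| + 1) ≤ 1 := by
    rw [abs_of_pos (inv_pos.mpr hp), inv_mul_cancel₀ hp.ne']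
  have k1 := key ((|K| + 1)⁻¹) hq τ hτ x hx
  have k2 := key (-(|K| + 1)⁻¹) (by rw [abs_neg]; exact hq) τ hτ x hx
  have k3 : (|K| + 1)⁻¹ * (V τ x - 1) = 0 := by linarith
  rcases mul_eq_zero.mp k3 with h | h
  · exact absurd h (inv_pos.mpr hp).ne'
  · linarith
end

section
/- Let I = (ℓ,r) be an open interval, 𝔰, 𝔟 : I → ℝ, and λ > 0. Call u : I → ℝ a classical solution of the resolvent equation if u is twice differentiable on I and satisfies (𝔰²(x)/2)·u''(x) + 𝔟(x)𝔰(x)·u'(x) - λ·u(x) + 1 = 0 for all x ∈ I. Assume that every nonnegative classical solution u of the resolvent equation satisfies u(x) ≥ 1/λ for all x ∈ I (i.e., the constant function 1/λ is the smallest nonnegative classical solution). Then every bounded classical solution 𝔲 of the resolvent equation satisfies 𝔲(x) = 1/λ for all x ∈ I. -/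
open Set

/-- `u` is a classical solution on the open interval `I` of the resolvent equation
`(𝔰²/2)u'' + 𝔟𝔰u' - λu + 1 = 0`: `u` is twice differentiable on `I`, with first and
second derivatives witnessed by some functions `u', u''`, and satisfies the equation
pointwise on `I`. -/
def IsClassicalSolResolvent (I : Set ℝ) (𝔰 𝔟 : ℝ → ℝ) (lam : ℝ) (u : ℝ → ℝ) : Prop :=
  ∃ u' u'' : ℝ → ℝ,
    (∀ x ∈ I, HasDerivAt u (u' x) x) ∧
    (∀ x ∈ I, HasDerivAt u' (u'' x) x) ∧
    ∀ x ∈ I, (𝔰 x) ^ 2 / 2 * u'' x + 𝔟 x * 𝔰 x * u' x - lam * u x + 1 = 0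

/-- **Unique bounded solution of the resolvent equation (Proposition 4.9).**
Let `I = (ℓ, r)`, `𝔰, 𝔟 : I → ℝ` and `λ > 0`. Assume the constant function `1/λ` is the
smallest nonnegative classical solution of the resolvent equation, i.e. every nonnegative
classical solution dominates `1/λ` on `I`. Then every bounded classical solution `𝔲`
equals `1/λ` on `I`. -/
theorem resolvent_equation_unique_bounded_solution
    (ℓ r : EReal) (hlr : ℓ < r)
    (I : Set ℝ) (hI : I = {x : ℝ | ℓ < (x : EReal) ∧ (x : EReal) < r})
    (𝔰 𝔟 : ℝ → ℝ) (lam : ℝ) (hlam : 0 < lam)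
    (hmin : ∀ u : ℝ → ℝ, IsClassicalSolResolvent I 𝔰 𝔟 lam u →
      (∀ x ∈ I, 0 ≤ u x) → ∀ x ∈ I, 1 / lam ≤ u x)
    (𝔲 : ℝ → ℝ) (h𝔲 : IsClassicalSolResolvent I 𝔰 𝔟 lam 𝔲)
    (h𝔲bdd : ∃ K : ℝ, ∀ x ∈ I, |𝔲 x| ≤ K) :
    ∀ x ∈ I, 𝔲 x = 1 / lam := by
  obtain ⟨K, hK⟩ := h𝔲bdd
  obtain ⟨u', u'', h1, h2, h3⟩ := h𝔲
  have hl : lam * (1 / lam) = 1 := by field_simp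
  have hp : 0 < 1 / lam := by positivity
  set L := 1 / lam with hL
  have hM : 0 < |K| + L := by positivity
  have key : ∀ c : ℝ, |c| * (|K| + L) ≤ L → ∀ x ∈ I, 0 ≤ c * (𝔲 x - L) := by
    intro c hc x hx
    have := hmin (fun y => L + c * (𝔲 y - L)) ?_ ?_ x hx
    · skip
      linarith
    · refine ⟨fun y => c * u' y, fun y => c * u'' y, ?_, ?_, ?_⟩
      · intro y hy
        exact (((h1 y hy).sub_const L).const_mul c).const_add L
      · intro y hy
        exact (h2 y hy).const_mul c
      · intro y hy
        have := h3 y hy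
        linear_combination c * this + (c - 1) * hl
    · intro y hy
      have hw : |𝔲 y - L| ≤ |K| + L := by
        have a := hK y hy
        have b := le_abs_self K
        have d := abs_sub (𝔲 y) L
        rw [abs_of_pos hp] at d
        linarith
      have e : |c * (𝔲 y - L)| ≤ L := by
        rw [abs_mul]
        exact (mul_le_mul_of_nonneg_left hw (abs_nonneg c)).trans hc
      have := (abs_le.mp e).1
      linarith
  intro x hx
  have hc : 0 < L / (|K| + L) := by positivity
  have e : L / (|K| + L) * (|K| + L) = L := div_mul_cancel₀ _ hM.ne'
  have p := key (L / (|K| + L)) (by rw [abs_of_pos hc, e]) x hx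
  have q := key (-(L / (|K| + L))) (by rw [abs_neg, abs_of_pos hc, e]) x hx
  have z : L / (|K| + L) * (𝔲 x - L) = 0 := by linarith
  rcases mul_eq_zero.mp z with h | h
  · exact absurd h hc.ne'
  · linarith
end

section
/- Define U : (0,∞) × (0,∞) → ℝ by U(τ,x) = 2·∫_0^{1/(x√τ)} (2π)^{-1/2} e^{-r²/2} dr. Then U has continuous partial derivatives ∂_τU, ∂_xU, ∂²_xU on (0,∞) × (0,∞) satisfying ∂_τU(τ,x) = (x⁴/2)·∂²_xU(τ,x) + x³·∂_xU(τ,x) for all (τ,x) ∈ (0,∞) × (0,∞), and moreover lim_{τ↓0} U(τ,x) = 1 for every x > 0. -/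
open Set Filter intervalIntegral

lemma aux_int (z : ℝ) : HasDerivAt (fun z => 2 * ∫ q in (0 : ℝ)..z,
    (Real.sqrt (2 * Real.pi))⁻¹ * Real.exp (-q ^ 2 / 2))
    (2 * ((Real.sqrt (2 * Real.pi))⁻¹ * Real.exp (-z ^ 2 / 2))) z := by
  have hc : Continuous (fun q : ℝ => (Real.sqrt (2 * Real.pi))⁻¹ * Real.exp (-q ^ 2 / 2)) := by
    fun_prop
  exact (hc.integral_hasStrictDerivAt 0 z).hasDerivAt.const_mul 2

lemma aux_zt (x t : ℝ) (hx : 0 < x) (ht : 0 < t) :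
    HasDerivAt (fun t => 1 / (x * Real.sqrt t)) (-1 / (2 * x * Real.sqrt t * t)) t := by
  have hs : 0 < Real.sqrt t := Real.sqrt_pos.2 ht
  have h := (((Real.hasDerivAt_sqrt ht.ne').const_mul x).inv (by positivity))
  simp only [one_div]
  refine h.congr_deriv ?_
  have e : t = Real.sqrt t ^ 2 := (Real.sq_sqrt ht.le).symm
  generalize Real.sqrt t = s at *
  subst e
  field_simp

lemma aux_zx (x s : ℝ) (hx : 0 < x) (hs : 0 < s) :
    HasDerivAt (fun x => 1 / (x * s)) (-1 / (x ^ 2 * s)) x := by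
  have h := (((hasDerivAt_id x).mul_const s).inv (by simp; constructor <;> positivity))
  simp only [one_div]
  refine h.congr_deriv ?_
  simp only [id]
  field_simp

lemma aux_lim : Tendsto (fun z => 2 * ∫ q in (0 : ℝ)..z,
    (Real.sqrt (2 * Real.pi))⁻¹ * Real.exp (-q ^ 2 / 2)) atTop (nhds 1) := by
  have e : ∀ q : ℝ, -q ^ 2 / 2 = -(1/2) * q ^ 2 := fun q => by ring
  simp only [e]
  have hi : MeasureTheory.IntegrableOn (fun q : ℝ => (Real.sqrt (2 * Real.pi))⁻¹ *
      Real.exp (-(1/2) * q ^ 2)) (Ioi 0) :=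
    ((integrable_exp_neg_mul_sq (b := 1/2) (by norm_num)).const_mul _).integrableOn
  have h := (MeasureTheory.intervalIntegral_tendsto_integral_Ioi 0 hi tendsto_id).const_mul 2
  rw [MeasureTheory.integral_const_mul, integral_gaussian_Ioi] at h
  suffices hh : 2 * ((Real.sqrt (2 * Real.pi))⁻¹ * (Real.sqrt (Real.pi / (1/2)) / 2)) = 1 by
    rw [hh] at h
    exact h
  have : Real.pi / (1/2) = 2 * Real.pi := by ring
  rw [this]
  have : 0 < Real.sqrt (2 * Real.pi) := Real.sqrt_pos.2 (by positivity)
  field_simp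

/-- **The Gaussian tail formula solves the Cauchy problem for `dX = -X²dW + X³dt`.**
Let `U(τ,x) = 2 ∫_0^{1/(x√τ)} (2π)^{-1/2} e^{-r²/2} dr` on `(0,∞) × (0,∞)`. Then `U`
possesses continuous partial derivatives `∂_τ U, ∂_x U, ∂²_x U` on `(0,∞) × (0,∞)`
satisfying `∂_τ U = (x⁴/2) ∂²_x U + x³ ∂_x U`, and `U(τ,x) → 1` as `τ ↓ 0`, for every
`x > 0`. -/
theorem gaussian_tail_solves_quartic_cauchy_problem
    (U : ℝ → ℝ → ℝ)
    (hU : ∀ τ ∈ Set.Ioi (0 : ℝ), ∀ x ∈ Set.Ioi (0 : ℝ),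
      U τ x = 2 * ∫ q in (0 : ℝ)..(1 / (x * Real.sqrt τ)),
        (Real.sqrt (2 * Real.pi))⁻¹ * Real.exp (-q ^ 2 / 2)) :
    (∃ Uτ Ux Uxx : ℝ → ℝ → ℝ,
      ContinuousOn (fun p : ℝ × ℝ => Uτ p.1 p.2) (Set.Ioi 0 ×ˢ Set.Ioi 0) ∧
      ContinuousOn (fun p : ℝ × ℝ => Ux p.1 p.2) (Set.Ioi 0 ×ˢ Set.Ioi 0) ∧
      ContinuousOn (fun p : ℝ × ℝ => Uxx p.1 p.2) (Set.Ioi 0 ×ˢ Set.Ioi 0) ∧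
      ∀ τ ∈ Set.Ioi (0 : ℝ), ∀ x ∈ Set.Ioi (0 : ℝ),
        HasDerivAt (fun t => U t x) (Uτ τ x) τ ∧
        HasDerivAt (fun y => U τ y) (Ux τ x) x ∧
        HasDerivAt (fun y => Ux τ y) (Uxx τ x) x ∧
        Uτ τ x = x ^ 4 / 2 * Uxx τ x + x ^ 3 * Ux τ x) ∧
    ∀ x ∈ Set.Ioi (0 : ℝ),
      Tendsto (fun τ => U τ x) (nhdsWithin 0 (Set.Ioi 0)) (nhds 1) := by
  set c := (Real.sqrt (2 * Real.pi))⁻¹ with hc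
  refine ⟨⟨fun t x => 2 * (c * Real.exp (-(1 / (x * Real.sqrt t)) ^ 2 / 2)) *
      (-1 / (2 * x * Real.sqrt t * t)),
    fun t x => 2 * (c * Real.exp (-(1 / (x * Real.sqrt t)) ^ 2 / 2)) *
      (-1 / (x ^ 2 * Real.sqrt t)),
    fun t x => 2 * (c * Real.exp (-(1 / (x * Real.sqrt t)) ^ 2 / 2)) *
      (2 / (x ^ 3 * Real.sqrt t) - 1 / (x ^ 5 * Real.sqrt t * t)), ?_, ?_, ?_, ?_⟩, ?_⟩
  iterate 3
    rintro ⟨t, x⟩ ⟨ht, hx⟩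
    simp only [mem_Ioi] at ht hx
    have hs : 0 < Real.sqrt t := Real.sqrt_pos.2 ht
    apply ContinuousAt.continuousWithinAt
    fun_prop (disch := (simp only []; positivity))
  · intro t ht x hx
    simp only [mem_Ioi] at ht hx
    have hs : 0 < Real.sqrt t := Real.sqrt_pos.2 ht
    refine ⟨?_, ?_, ?_, ?_⟩
    · refine ((aux_int _).comp t (aux_zt x t hx ht)).congr_of_eventuallyEq ?_
      filter_upwards [Ioi_mem_nhds ht] with t' ht'
      exact hU t' ht' x hx
    · refine ((aux_int _).comp x (aux_zx x _ hx hs)).congr_of_eventuallyEq ?_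
      filter_upwards [Ioi_mem_nhds hx] with x' hx'
      exact hU t ht x' hx'
    · beta_reduce
      have e : t = Real.sqrt t ^ 2 := (Real.sq_sqrt ht.le).symm
      generalize Real.sqrt t = s at *
      subst e
      have h1 := ((((aux_zx x s hx hs).pow 2).neg.div_const 2).exp.const_mul c).const_mul 2
      have h2 := (((hasDerivAt_pow 2 x).mul_const s).inv (by positivity)).const_mul (-1)
      refine ((h1.mul h2).congr_of_eventuallyEq (Eventually.of_forall fun y => ?_)).congr_deriv ?_
      · simp [div_eq_mul_inv]
      simp
      field_simp
      ring
    · simp only []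
      field_simp
      ring
  · intro x hx
    simp only [mem_Ioi] at hx
    have hz : Tendsto (fun t => 1 / (x * Real.sqrt t)) (nhdsWithin 0 (Ioi 0)) atTop := by
      simp only [one_div]
      apply Tendsto.inv_tendsto_nhdsGT_zero
      refine tendsto_nhdsWithin_iff.2 ⟨?_, ?_⟩
      · have : Continuous (fun t => x * Real.sqrt t) := by fun_prop
        have := this.tendsto 0
        simp only [Real.sqrt_zero, mul_zero] at this
        exact this.mono_left nhdsWithin_le_nhds
      · filter_upwards [self_mem_nhdsWithin] with t ht
        exact mul_pos hx (Real.sqrt_pos.2 ht)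
    refine (aux_lim.comp hz).congr' ?_
    filter_upwards [self_mem_nhdsWithin] with t ht
    exact (hU t ht x hx).symm
end

section
/- For ν > 0 define the modified Bessel function of the second type by the series I_ν(u) = ∑_{n=0}^∞ (u/2)^{ν+2n} / (n!·Γ(n+ν+1)) for u ≥ 0. Then for every y > 0, 2·y^{ν/2}·e^{-y}·∫_0^∞ z^{1-ν}·e^{-z²}·I_ν(2z√y) dz = e^{-y}·∑_{k=0}^∞ y^{ν+k}/Γ(ν+k+1). -/
open Real MeasureTheory

lemma aux_summable (ν : ℝ) (hν : 0 < ν) (y : ℝ) (hy : 0 < y) :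
    Summable (fun k : ℕ => y ^ (k : ℕ) / Real.Gamma (ν + (k : ℝ) + 1)) := by
  have hG : ∀ k : ℕ, 0 < Real.Gamma (ν + (k : ℝ) + 1) := fun k =>
    Real.Gamma_pos_of_pos (by positivity)
  refine summable_of_ratio_test_tendsto_lt_one (l := 0) zero_lt_one
    (Filter.Eventually.of_forall fun k => ?_) ?_
  · have := hG k
    positivity
  · have h1 : ∀ k : ℕ, ‖y ^ (k + 1) / Real.Gamma (ν + ((k + 1 : ℕ) : ℝ) + 1)‖ /
        ‖y ^ k / Real.Gamma (ν + (k : ℝ) + 1)‖ = y / ((k : ℝ) + (ν + 1)) := by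
      intro k
      have h2 := hG k
      have h3 := hG (k + 1)
      rw [Real.norm_of_nonneg (by positivity), Real.norm_of_nonneg (by positivity)]
      have h4 : Real.Gamma (ν + ((k + 1 : ℕ) : ℝ) + 1)
          = ((k : ℝ) + (ν + 1)) * Real.Gamma (ν + (k : ℝ) + 1) := by
        have := Real.Gamma_add_one (s := ν + (k : ℝ) + 1) (by positivity)
        push_cast
        rw [← add_assoc ν, this]
        ring
      rw [h4]
      have h5 : (k : ℝ) + (ν + 1) ≠ 0 := by positivity
      field_simp
      ring
    simp_rw [h1]
    exact Filter.Tendsto.div_atTop tendsto_const_nhds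
      (Filter.tendsto_atTop_add_const_right _ _ tendsto_natCast_atTop_atTop)

/-- **Bessel-function integral identity.**
For `ν > 0` let `I_ν(u) = ∑_{n=0}^∞ (u/2)^{ν+2n} / (n! Γ(n+ν+1))` (`u ≥ 0`) denote the
modified Bessel function of the second type. Then for every `y > 0`,
`2 y^{ν/2} e^{-y} ∫_0^∞ z^{1-ν} e^{-z²} I_ν(2z√y) dz = e^{-y} ∑_{k=0}^∞ y^{ν+k}/Γ(ν+k+1)`. -/
theorem besselI_integral_identity
    (ν : ℝ) (hν : 0 < ν)
    (Iν : ℝ → ℝ)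
    (hIν : ∀ u : ℝ, 0 ≤ u →
      Iν u = ∑' n : ℕ, (u / 2) ^ (ν + 2 * (n : ℝ)) /
        ((n.factorial : ℝ) * Real.Gamma ((n : ℝ) + ν + 1)))
    (y : ℝ) (hy : 0 < y) :
    2 * y ^ (ν / 2) * Real.exp (-y) *
        (∫ z in Set.Ioi (0 : ℝ),
          z ^ (1 - ν) * Real.exp (-z ^ 2) * Iν (2 * z * Real.sqrt y)) =
      Real.exp (-y) * ∑' k : ℕ, y ^ (ν + (k : ℝ)) / Real.Gamma (ν + (k : ℝ) + 1) := by
  have hG : ∀ k : ℕ, 0 < Real.Gamma (ν + (k : ℝ) + 1) := fun k =>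
    Real.Gamma_pos_of_pos (by positivity)
  have hs : 0 < Real.sqrt y := Real.sqrt_pos.mpr hy
  let c : ℕ → ℝ := fun n => Real.sqrt y ^ (ν + 2 * (n : ℝ)) /
    ((n.factorial : ℝ) * Real.Gamma (ν + (n : ℝ) + 1))
  have hc : ∀ n, 0 ≤ c n := fun n => by
    have := hG n
    simp only [c]
    positivity
  let F : ℕ → ℝ → ℝ := fun n z => c n * (z ^ (1 + 2 * (n : ℝ)) * Real.exp (-z ^ (2 : ℝ)))
  have hq : ∀ n : ℕ, (-1 : ℝ) < 1 + 2 * (n : ℝ) := fun n => by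
    have : (0 : ℝ) ≤ n := n.cast_nonneg
    linarith
  have hF : ∀ n, Integrable (F n) (volume.restrict (Set.Ioi 0)) := fun n =>
    (integrableOn_rpow_mul_exp_neg_rpow (hq n) two_pos).const_mul (c n)
  have hrw : ∀ n : ℕ, Real.sqrt y ^ (ν + 2 * (n : ℝ)) = y ^ (ν / 2) * y ^ n := fun n => by
    rw [Real.sqrt_eq_rpow, ← Real.rpow_mul hy.le, ← Real.rpow_natCast y n, ← Real.rpow_add hy]
    congr 1
    ring
  have hI : ∀ n, ∫ z in Set.Ioi (0 : ℝ), F n z =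
      y ^ (ν / 2) / 2 * (y ^ n / Real.Gamma (ν + (n : ℝ) + 1)) := fun n => by
    simp only [F]
    rw [integral_const_mul, integral_rpow_mul_exp_neg_rpow two_pos (hq n)]
    have h1 : (1 + 2 * (n : ℝ) + 1) / 2 = n + 1 := by ring
    rw [h1, Real.Gamma_nat_eq_factorial]
    simp only [c]
    rw [hrw]
    have h2 := (hG n).ne'
    have h3 : (n.factorial : ℝ) ≠ 0 := by positivity
    field_simp
  have hN : ∀ n, ∫ z in Set.Ioi (0 : ℝ), ‖F n z‖ = ∫ z in Set.Ioi (0 : ℝ), F n z := fun n => by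
    refine setIntegral_congr_fun measurableSet_Ioi fun z hz => ?_
    have hz' : 0 < z := hz
    have := hc n
    exact Real.norm_of_nonneg (by simp only [F]; positivity)
  have hS : Summable fun n => ∫ z in Set.Ioi (0 : ℝ), ‖F n z‖ := by
    simp_rw [hN, hI]
    exact (aux_summable ν hν y hy).mul_left _
  have key := integral_tsum_of_summable_integral_norm hF hS
  have hint : ∫ z in Set.Ioi (0 : ℝ),
      z ^ (1 - ν) * Real.exp (-z ^ 2) * Iν (2 * z * Real.sqrt y) =
      ∫ z in Set.Ioi (0 : ℝ), ∑' n, F n z := by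
    refine setIntegral_congr_fun measurableSet_Ioi fun z hz => ?_
    have hz' : 0 < z := hz
    rw [hIν _ (by positivity), ← tsum_mul_left]
    refine tsum_congr fun n => ?_
    simp only [F, c]
    have h1 : 2 * z * Real.sqrt y / 2 = z * Real.sqrt y := by ring
    have h2 : z ^ (1 + 2 * (n : ℝ)) = z ^ (1 - ν) * z ^ (ν + 2 * (n : ℝ)) := by
      rw [← Real.rpow_add hz']
      congr 1
      ring
    rw [h1, Real.mul_rpow hz'.le hs.le, h2, Real.rpow_two, add_comm (n : ℝ) ν]
    ring
  rw [hint, ← key]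
  simp_rw [hI]
  rw [tsum_mul_left]
  have hR : ∀ k : ℕ, y ^ (ν + (k : ℝ)) / Real.Gamma (ν + (k : ℝ) + 1) =
      (y ^ (ν / 2) * y ^ (ν / 2)) * (y ^ k / Real.Gamma (ν + (k : ℝ) + 1)) := fun k => by
    rw [← Real.rpow_add hy, add_halves, Real.rpow_add hy, Real.rpow_natCast]
    ring
  simp_rw [hR]
  rw [tsum_mul_left]
  ring
end
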